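/- Let p be a prime, r ≥ 2, m ≥ 1, and let A be an m × m matrix over Z_{p^r}. For 1 ≤ k ≤ r, let s_k denote the system height of ((Z_{p^k})^m, x ↦ (A mod p^k) x). Then s_r ≤ s_1 + s_{r-1}. -/

import Mathlib

/-- An element `x` is a cycle vertex of the system `(M, f)` if `f^[l] x = x`
for some positive integer `l`. -/
def IsCycleVertex {M : Type*} (f : M → M) (x : M) : Prop :=
  ∃ l : ℕ, 0 < l ∧ f^[l] x = x

/-- The height of an element `x`: the least `k` such that `f^[k] x` is a cycle vertex. -/
noncomputable def height {M : Type*} (f : M → M) (x : M) : ℕ :=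
  sInf {k : ℕ | IsCycleVertex f (f^[k] x)}

/-- The system height: the maximum height over all elements. -/
noncomputable def systemHeight {M : Type*} (f : M → M) : ℕ :=
  sSup (Set.range (height f))

theorem IsCycleVertex.iterate {M : Type*} {f : M → M} {x : M} (h : IsCycleVertex f x) (n : ℕ) :
    IsCycleVertex f (f^[n] x) := by
  obtain ⟨l, hl, h⟩ := h
  exact ⟨l, hl, Function.IsPeriodicPt.apply_iterate (show Function.IsPeriodicPt f l x from h) n⟩

theorem exists_isCycleVertex_iterate {M : Type*} [Finite M] (f : M → M) (x : M) :
    ∃ k, IsCycleVertex f (f^[k] x) := by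
  obtain ⟨i, j, hij, h⟩ := Finite.exists_ne_map_eq_of_infinite (fun k : ℕ => f^[k] x)
  wlog hlt : i < j generalizing i j
  · exact this j i hij.symm h.symm (by omega)
  refine ⟨i, j - i, by omega, ?_⟩
  rw [← Function.iterate_add_apply, Nat.sub_add_cancel hlt.le]
  exact h.symm

theorem isCycleVertex_iterate_systemHeight {M : Type*} [Finite M] (f : M → M) (x : M) :
    IsCycleVertex f (f^[systemHeight f] x) := by
  have hmem : IsCycleVertex f (f^[height f x] x) :=
    Nat.sInf_mem (exists_isCycleVertex_iterate f x)
  have hle : height f x ≤ systemHeight f :=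
    le_csSup (Set.finite_range _).bddAbove ⟨x, rfl⟩
  have := hmem.iterate (systemHeight f - height f x)
  rwa [← Function.iterate_add_apply, Nat.sub_add_cancel hle] at this

theorem systemHeight_le {M : Type*} [Nonempty M] {f : M → M} {N : ℕ}
    (h : ∀ x, IsCycleVertex f (f^[N] x)) : systemHeight f ≤ N := by
  refine csSup_le (Set.range_nonempty _) ?_
  rintro _ ⟨x, rfl⟩
  exact Nat.sInf_le (h x)

/-- On a finite system there is a common period of all cycle vertices. -/
theorem exists_common_period {M : Type*} [Finite M] (f : M → M) :
    ∃ l : ℕ, 0 < l ∧ ∀ x, Function.IsPeriodicPt f l (f^[systemHeight f] x) := by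
  cases nonempty_fintype M
  choose l hl h using isCycleVertex_iterate_systemHeight f
  refine ⟨∏ x, l x, Finset.prod_pos fun x _ => hl x, fun x => ?_⟩
  exact Function.IsPeriodicPt.trans_dvd (h x) (Finset.dvd_prod_of_mem l (Finset.mem_univ x))

theorem ZMod.exists_eq_pow_mul_of_castHom_eq_zero {p k r : ℕ} [NeZero (p ^ r)] (h : p ^ k ∣ p ^ r)
    (v : ZMod (p ^ r)) (hv : ZMod.castHom h (ZMod (p ^ k)) v = 0) :
    ∃ c : ZMod (p ^ r), v = (p : ZMod (p ^ r)) ^ k * c := by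
  obtain ⟨n, rfl⟩ := ZMod.natCast_zmod_surjective v
  rw [map_natCast, ZMod.natCast_eq_zero_iff] at hv
  obtain ⟨c, rfl⟩ := hv
  exact ⟨c, by push_cast; rfl⟩

theorem Matrix.iterate_mulVec {n R : Type*} [Fintype n] [DecidableEq n] [CommRing R]
    (A : Matrix n n R) (k : ℕ) (x : n → R) : A.mulVec^[k] x = (A ^ k).mulVec x := by
  induction k with
  | zero => simp
  | succ k ih => rw [Function.iterate_succ_apply', ih, Matrix.mulVec_mulVec, pow_succ']

theorem Matrix.pow_mul_mulVec_eq_add_nsmul {n R : Type*} [Fintype n] [DecidableEq n] [CommRing R]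
    (B : Matrix n n R) {w u : n → R} (hw : B.mulVec w = w + u) (hu : B.mulVec u = u) (k : ℕ) :
    (B ^ k).mulVec w = w + k • u := by
  induction k with
  | zero => simp
  | succ k ih =>
    rw [pow_succ', ← Matrix.mulVec_mulVec, ih, Matrix.mulVec_add, hw, Matrix.mulVec_smul, hu,
      succ_nsmul']
    abel

/-- If `l` is a period of `B ^ a x` over `ZMod (p ^ k)`, then `B ^ l - 1` maps `A ^ a x`
to a multiple of `p ^ k`, for any lift `A` of `B`. -/
theorem Matrix.exists_pow_mulVec_eq_add_pow_smul {p k r : ℕ} [NeZero (p ^ r)] {n : Type*}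
    [Fintype n] [DecidableEq n] (h : p ^ k ∣ p ^ r) (A : Matrix n n (ZMod (p ^ r))) {a l : ℕ}
    (hl : ∀ x, Function.IsPeriodicPt (A.map (ZMod.castHom h (ZMod (p ^ k)))).mulVec l
      ((A.map (ZMod.castHom h (ZMod (p ^ k)))).mulVec^[a] x)) (x : n → ZMod (p ^ r)) :
    ∃ z, (A ^ l).mulVec ((A ^ a).mulVec x) = (A ^ a).mulVec x + (p : ZMod (p ^ r)) ^ k • z := by
  set φ := ZMod.castHom h (ZMod (p ^ k))
  have hx := hl (φ ∘ x)
  rw [Function.IsPeriodicPt, Function.IsFixedPt, Matrix.iterate_mulVec, Matrix.iterate_mulVec,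
    ← Matrix.map_pow, ← Matrix.map_pow] at hx
  have key : ∀ i, ∃ c, ((A ^ l).mulVec ((A ^ a).mulVec x) - (A ^ a).mulVec x) i
      = (p : ZMod (p ^ r)) ^ k * c := by
    intro i
    refine ZMod.exists_eq_pow_mul_of_castHom_eq_zero h _ ?_
    have e : ∀ (B : Matrix n n (ZMod (p ^ r))) y, (B.map φ).mulVec (φ ∘ y) = φ ∘ B.mulVec y :=
      fun B y => funext fun i => (RingHom.map_mulVec φ B y i).symm
    rw [e, e] at hx
    rw [Pi.sub_apply, map_sub, sub_eq_zero]
    exact congrFun hx i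
  choose z hz using key
  refine ⟨z, ?_⟩
  rw [← sub_eq_iff_eq_add']
  exact funext hz

/-- Writing `s k` for the system height of `((ZMod (p^k))^m, x ↦ (A mod p^k) x)`,
one has `s r ≤ s 1 + s (r - 1)`. -/
theorem systemHeight_recursion_step
    (p r m : ℕ) (hp : p.Prime) (hr : 2 ≤ r) (hm : 1 ≤ m)
    (A : Matrix (Fin m) (Fin m) (ZMod (p ^ r)))
    (s : ℕ → ℕ)
    (hs : ∀ k : ℕ, 1 ≤ k → k ≤ r →
      s k = systemHeight ((A.map (ZMod.cast : ZMod (p ^ r) → ZMod (p ^ k))).mulVec)) :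
    s r ≤ s 1 + s (r - 1) := by
  have hne : ∀ k, NeZero (p ^ k) := fun k => ⟨pow_ne_zero k hp.ne_zero⟩
  have period : ∀ k, 1 ≤ k → k ≤ r → ∃ l, 0 < l ∧ ∀ d x, ∃ z,
      (A ^ (l * d)).mulVec ((A ^ s k).mulVec x)
        = (A ^ s k).mulVec x + (p : ZMod (p ^ r)) ^ k • z := by
    intro k hk hkr
    obtain ⟨l, hl, h⟩ :=
      exists_common_period (A.map (ZMod.cast : ZMod (p ^ r) → ZMod (p ^ k))).mulVec
    rw [← hs k hk hkr] at h
    exact ⟨l, hl, fun d x => Matrix.exists_pow_mulVec_eq_add_pow_smul (pow_dvd_pow p hkr) A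
      (fun x => (h x).mul_const d) x⟩
  obtain ⟨l₁, hl₁, h₁⟩ := period 1 le_rfl (by omega)
  obtain ⟨l₂, hl₂, h₂⟩ := period (r - 1) (by omega) (by omega)
  have hid : A.map (ZMod.cast : ZMod (p ^ r) → ZMod (p ^ r)) = A := by
    ext i j
    simp
  rw [hs r (by omega) le_rfl, hid]
  have hpr : (p : ZMod (p ^ r)) ^ r = 0 := by
    rw [← Nat.cast_pow, ZMod.natCast_self]
  refine systemHeight_le fun x => ⟨l₁ * l₂ * p ^ r, by
    have := hp.pos
    positivity, ?_⟩
  obtain ⟨z, hz⟩ := h₂ l₁ x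
  obtain ⟨t, ht⟩ := h₁ l₂ z
  rw [mul_comm l₂] at hz
  rw [Matrix.iterate_mulVec, Matrix.iterate_mulVec, pow_mul,
    Matrix.pow_mul_mulVec_eq_add_nsmul (A ^ (l₁ * l₂))
      (u := (p : ZMod (p ^ r)) ^ (r - 1) • (A ^ s 1).mulVec z)]
  · rw [← Nat.cast_smul_eq_nsmul (ZMod (p ^ r)), ZMod.natCast_self, zero_smul, add_zero]
  · have hcomm : A ^ (l₁ * l₂) * A ^ s 1 = A ^ s 1 * A ^ (l₁ * l₂) := pow_mul_comm A _ _
    rw [pow_add, Matrix.mulVec_mulVec, ← mul_assoc, hcomm, mul_assoc,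
      ← Matrix.mulVec_mulVec, ← Matrix.mulVec_mulVec, hz, Matrix.mulVec_add, Matrix.mulVec_smul,
      Matrix.mulVec_mulVec]
  · rw [Matrix.mulVec_smul, ht, smul_add, smul_smul, ← pow_add, Nat.sub_add_cancel (by omega),
      hpr, zero_smul, add_zero]
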